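/- Shoenfield's limit lemma: A point p ∈ ℕ^ℕ is limit computable (i.e., p = lim_{i→∞} pᵢ for some computable sequence (pᵢ) in ℕ^ℕ) if and only if p ≤_T 0', i.e., p is computable relative to the halting problem. -/

import Mathlib

open scoped Classical

namespace LimitComp

/-- Baire space `ℕ^ℕ`. -/
abbrev Baire : Type := ℕ → ℕ

/-- The finite prefix of length `k` of a point of Baire space. -/
def pre (p : Baire) (k : ℕ) : List ℕ := List.ofFn fun i : Fin k => p i

/-- Interleaving pairing `⟨q,p⟩(2n) = q(n)`, `⟨q,p⟩(2n+1) = p(n)`. -/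
def pairB (q p : Baire) : Baire := fun n => if n % 2 = 0 then q (n / 2) else p (n / 2)

/-- The `i`-th component of a tupling `⟨p₀,p₁,p₂,...⟩`. -/
def seqOf (p : Baire) (i : ℕ) : Baire := fun n => p (Nat.pair i n)

/-- Tupling `⟨p₀,p₁,p₂,...⟩` of a sequence of points of Baire space. -/
def tup (ps : ℕ → Baire) : Baire := fun m => ps m.unpair.1 m.unpair.2

/-- The limit map `lim :⊆ ℕ^ℕ → ℕ^ℕ`; it maps `⟨p₀,p₁,p₂,...⟩` to its pointwise
limit, which is defined whenever every coordinate is eventually constant. -/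
noncomputable def limB : Baire →. Baire := fun p =>
  ⟨∀ n, ∃ i₀, ∀ i, i₀ ≤ i → seqOf p i n = seqOf p i₀ n,
   fun h n => seqOf p (Classical.choose (h n)) n⟩

/-- Monotonicity of a finite approximation function under prefix extension
(this corresponds to a one-way output tape). -/
def PrefixMono (η : List ℕ → ℕ → Option ℕ) : Prop :=
  ∀ u v n y, u <+: v → η u n = some y → η v n = some y

/-- `η` approximates the partial function `F`: for every input in the domain of `F`
every output position is eventually filled with the correct output value. -/
def OneWayApprox (η : List ℕ → ℕ → Option ℕ) (F : Baire →. Baire) : Prop :=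
  ∀ p q, q ∈ F p → ∀ n, ∃ k, η (pre p k) n = some (q n)

/-- Computability for partial functions on Baire space: `F` is computed by a
Turing machine with one-way output tape, formalized via a computable monotone
finite approximation function. -/
def ComputableFn (F : Baire →. Baire) : Prop :=
  ∃ η : List ℕ → ℕ → Option ℕ, Computable₂ η ∧ PrefixMono η ∧ OneWayApprox η F

/-- `η` is a limit approximation of `F`: on every input in the domain of `F`,
every output cell eventually stabilizes to the correct output value. -/
def LimitApprox (η : List ℕ → ℕ → ℕ) (F : Baire →. Baire) : Prop :=
  ∀ p q, q ∈ F p → ∀ n, ∃ k₀, ∀ k, k₀ ≤ k → η (pre p k) n = q n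

/-- Limit computability for partial functions on Baire space: `F` is computed by
a Turing machine with a two-way output tape such that on inputs in the domain
every output cell eventually stabilizes. -/
def LimitComputableFn (F : Baire →. Baire) : Prop :=
  ∃ η : List ℕ → ℕ → ℕ, Computable₂ η ∧ LimitApprox η F

/-- The `i`-th Turing machine halts on input `p ∈ ℕ^ℕ` (i.e. it halts after
having read some finite prefix of `p`). -/
def haltsOn (i : ℕ) (p : Baire) : Prop :=
  ∃ k, ((Denumerable.ofNat Nat.Partrec.Code i).eval (Encodable.encode (pre p k))).Dom

/-- The Turing jump operator `J : ℕ^ℕ → ℕ^ℕ`. -/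
noncomputable def jump (p : Baire) : Baire := fun i => if haltsOn i p then 1 else 0

/-- The halting problem `0'`. -/
noncomputable def zero' : Baire := jump fun _ => 0

/-- `F` is computable relative to the oracle `q`. -/
def ComputableRel (q : Baire) (F : Baire →. Baire) : Prop :=
  ∃ G : Baire →. Baire, ComputableFn G ∧ ∀ p r, r ∈ F p → r ∈ G (pairB q p)

/-- `F` is limit computable relative to the oracle `q`. -/
def LimitComputableRel (q : Baire) (F : Baire →. Baire) : Prop :=
  ∃ G : Baire →. Baire, LimitComputableFn G ∧ ∀ p r, r ∈ F p → r ∈ G (pairB q p)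

/-- Turing reducibility for points of Baire space. -/
def TuringLe (p q : Baire) : Prop :=
  ∃ F : Baire →. Baire, ComputableFn F ∧ p ∈ F q

end LimitComp

namespace LimitComp

open Nat.Partrec (Code)

theorem pre_eq_map_range (p : Baire) (k : ℕ) : pre p k = (List.range k).map p := by
  apply List.ext_getElem <;> simp [pre]

theorem length_pre (p : Baire) (k : ℕ) : (pre p k).length = k := by
  simp [pre]

theorem pre_getElem? {p : Baire} {k i y : ℕ} :
    (pre p k)[i]? = some y ↔ i < k ∧ p i = y := by
  rw [pre_eq_map_range, List.getElem?_eq_some_iff]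
  simp

theorem pre_prefix_pre {p q : Baire} {k l : ℕ} (hkl : k ≤ l) (h : ∀ i < k, p i = q i) :
    pre p k <+: pre q l := by
  rw [List.prefix_iff_getElem?]
  intro i hi
  have hi' : i < k := by simpa [length_pre] using hi
  refine pre_getElem?.2 ⟨hi'.trans_le hkl, ?_⟩
  simp [pre, h i hi']

theorem zero'_eq_zero_iff (i : ℕ) : zero' i = 0 ↔ ¬ haltsOn i fun _ => 0 := by
  simp [zero', jump]

/-- Emptiness of a computable search is uniformly decided by a query to the halting problem. -/
theorem exists_primrec_query {p : ℕ → ℕ → Bool} (hp : Computable₂ p) :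
    ∃ g : ℕ → ℕ, Primrec g ∧ ∀ a, zero' (g a) = 0 ↔ ∀ j, p a j = false := by
  have hsearch : Partrec fun x : ℕ => Nat.rfind fun j => (p x.unpair.1 j : Part Bool) :=
    Partrec.rfind <| Computable.partrec <|
      hp.comp ((Primrec.fst.comp Primrec.unpair).to_comp.comp Computable.fst) Computable.snd
  obtain ⟨c, hc⟩ := Code.exists_code.1 (Partrec.nat_iff.1 hsearch)
  refine ⟨fun a => Encodable.encode (c.curry a),
    Primrec.encode.comp (Code.primrec₂_curry.comp (Primrec.const c) Primrec.id), fun a => ?_⟩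
  have hdom : ∀ x, ((c.curry a).eval x).Dom ↔ ∃ j, p a j = true := by
    intro x
    rw [Code.eval_curry, hc]
    refine Nat.rfind_dom.trans (exists_congr fun j => ?_)
    simp only [Nat.unpair_pair, Part.coe_some, Part.mem_some_iff, Part.some_dom, implies_true,
      and_true]
    exact eq_comm
  simp only [zero'_eq_zero_iff, haltsOn, Denumerable.ofNat_encode, hdom]
  simp

/-- The halting problem is the pointwise limit of a primitive recursive sequence. -/
theorem exists_primrec_approx_zero' :
    ∃ z : ℕ → ℕ → ℕ, Primrec₂ z ∧ ∀ i, ∃ s₀, ∀ s, s₀ ≤ s → z s i = zero' i := by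
  let run : ℕ → ℕ → ℕ → Option ℕ := fun s i k =>
    Code.evaln s (Denumerable.ofNat Code i) (Encodable.encode ((List.range k).map fun _ => 0))
  have hrun : Primrec fun a : (ℕ × ℕ) × ℕ => run a.1.1 a.1.2 a.2 :=
    Code.primrec_evaln.comp <|
      ((Primrec.fst.comp Primrec.fst).pair
        ((Primrec.ofNat Code).comp (Primrec.snd.comp Primrec.fst))).pair
      (Primrec.encode.comp
        (Primrec.list_map (Primrec.list_range.comp Primrec.snd) (Primrec.const 0).to₂))
  let outputs : ℕ → ℕ → List ℕ := fun s i => (List.range s).filterMap (run s i)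
  have houtputs : Primrec₂ outputs :=
    Primrec.listFilterMap (Primrec.list_range.comp Primrec.fst) hrun.to₂
  have hmem : ∀ s i, outputs s i ≠ [] ↔ ∃ k < s, ∃ y, run s i k = some y := by
    intro s i
    simp only [outputs, ne_eq, List.filterMap_eq_nil_iff, List.mem_range]
    push Not
    simp only [Option.ne_none_iff_exists']
  have hsound : ∀ s i, outputs s i ≠ [] → haltsOn i fun _ => 0 := by
    intro s i h
    obtain ⟨k, -, y, hy⟩ := (hmem s i).1 h
    refine ⟨k, Part.dom_iff_mem.2 ⟨y, Code.evaln_sound (k := s) ?_⟩⟩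
    rw [pre_eq_map_range]
    exact hy
  refine ⟨fun s i => min (outputs s i).length 1,
    Primrec.nat_min.comp₂ (Primrec.list_length.comp₂ houtputs) (Primrec.const 1).to₂,
    fun i => ?_⟩
  by_cases h : haltsOn i fun _ => 0
  · obtain ⟨k, hk⟩ := h
    obtain ⟨y, hy⟩ := Part.dom_iff_mem.1 hk
    obtain ⟨t, ht⟩ := Code.evaln_complete.1 hy
    refine ⟨max t (k + 1), fun s hs => ?_⟩
    have hne : outputs s i ≠ [] := by
      refine (hmem s i).2 ⟨k, by omega, y, ?_⟩
      have := Code.evaln_mono (le_trans (le_max_left _ _) hs) ht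
      rw [pre_eq_map_range] at this
      exact this
    have := List.length_pos_iff.2 hne
    rw [zero', jump, if_pos ⟨k, hk⟩]
    exact min_eq_right this
  · refine ⟨0, fun s _ => ?_⟩
    have : outputs s i = [] := by
      by_contra hne
      exact h (hsound s i hne)
    simp [this, zero', jump, h]

/-- A point computable from a limit of a computable sequence is itself such a limit. -/
theorem TuringLe.exists_limit {p q : Baire} (h : TuringLe p q) {z : ℕ → ℕ → ℕ}
    (hlim : ∀ i, ∃ s₀, ∀ s, s₀ ≤ s → z s i = q i)
    (hpre : Computable fun s => pre (z s) s) :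
    ∃ f : ℕ → ℕ → ℕ, Computable₂ f ∧ ∀ n, ∃ i₀, ∀ i, i₀ ≤ i → f i n = p n := by
  obtain ⟨F, ⟨η, hη, hmono, happrox⟩, hF⟩ := h
  refine ⟨fun s n => (η (pre (z s) s) n).getD 0,
    Computable.option_getD (hη.comp (hpre.comp Computable.fst) Computable.snd)
      (Computable.const 0), fun n => ?_⟩
  obtain ⟨k, hk⟩ := happrox q p hF n
  choose s₀ hs₀ using hlim
  refine ⟨max k ((Finset.range k).sup s₀), fun s hs => ?_⟩
  have hle := max_le_iff.1 hs
  have hprefix : pre q k <+: pre (z s) s := pre_prefix_pre hle.1 fun i hi =>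
    (hs₀ i s ((Finset.le_sup (Finset.mem_range.2 hi)).trans hle.2)).symm
  simp [hmono _ _ n _ hprefix hk]

/-- If `g n m` is a query to `q` whose answer is `0` precisely for the stages `m` from which on
`f · n` is constant, then `q` computes the limit of `f`. -/
theorem turingLe_of_queries {p q : Baire} {f g : ℕ → ℕ → ℕ} (hf : Computable₂ f)
    (hg : Primrec₂ g) (hlim : ∀ n, ∃ i₀, ∀ i, i₀ ≤ i → f i n = p n)
    (hq : ∀ n m, q (g n m) = 0 ↔ ∀ j, m ≤ j → f j n = f m n) : TuringLe p q := by
  let test : List ℕ × ℕ → ℕ → Option ℕ := fun a s =>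
    if a.1[s.unpair.2]? = some 0 ∧ s.unpair.2 = g a.2 s.unpair.1 then some s.unpair.1 else none
  have hfst : Primrec fun b : (List ℕ × ℕ) × ℕ => b.2.unpair.1 :=
    Primrec.fst.comp (Primrec.unpair.comp Primrec.snd)
  have hsnd : Primrec fun b : (List ℕ × ℕ) × ℕ => b.2.unpair.2 :=
    Primrec.snd.comp (Primrec.unpair.comp Primrec.snd)
  have htest : Primrec₂ test :=
    Primrec.ite
      ((Primrec.eq.comp
          (Primrec.list_getElem?.comp (Primrec.fst.comp Primrec.fst) hsnd)
          (Primrec.const (some 0))).and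
        (Primrec.eq.comp hsnd (hg.comp (Primrec.snd.comp Primrec.fst) hfst)))
      (Primrec.option_some.comp hfst) (Primrec.const none)
  have test_eq : ∀ u n s m, test (u, n) s = some m ↔
      u[s.unpair.2]? = some 0 ∧ s.unpair.2 = g n m ∧ s.unpair.1 = m := by
    intro u n s m
    simp only [test, Option.ite_none_right_eq_some, Option.some.injEq]
    constructor
    · rintro ⟨⟨h₁, h₂⟩, rfl⟩
      exact ⟨h₁, h₂, rfl⟩
    · rintro ⟨h₁, h₂, rfl⟩
      exact ⟨⟨h₁, h₂⟩, rfl⟩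
  let search : List ℕ → ℕ → Option ℕ := fun u n => (List.range u.length).findSome? (test (u, n))
  have hsearch : Primrec₂ search := by
    have : Primrec fun a : List ℕ × ℕ => ((List.range a.1.length).filterMap (test a)).head? :=
      Primrec.list_head?.comp (Primrec.listFilterMap
        (Primrec.list_range.comp (Primrec.list_length.comp Primrec.fst)) htest)
    exact this.of_eq fun a => List.head?_filterMap
  have search_mono : PrefixMono search := by
    rintro u v n m ⟨w, rfl⟩ h
    have hagree : (List.range u.length).findSome? (test (u ++ w, n)) = search u n := by
      simp only [search, ← List.head?_filterMap]
      refine congrArg _ (List.filterMap_congr fun s hs => ?_)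
      have : s.unpair.2 < u.length := (Nat.unpair_right_le s).trans_lt (List.mem_range.1 hs)
      simp only [test, List.getElem?_append_left this]
    simp only [search, List.length_append, List.range_add, List.findSome?_append]
    rw [hagree, h, Option.some_or]
  have search_sound : ∀ k n m, search (pre q k) n = some m → f m n = p n := by
    intro k n m h
    obtain ⟨s, -, hs⟩ := List.exists_of_findSome?_eq_some h
    obtain ⟨h₁, h₂, -⟩ := (test_eq _ _ _ _).1 hs
    have hzero : q (g n m) = 0 := h₂ ▸ (pre_getElem?.1 h₁).2
    obtain ⟨i₀, hi₀⟩ := hlim n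
    rw [← (hq n m).1 hzero _ (le_max_left m i₀), hi₀ _ (le_max_right m i₀)]
  have search_complete : ∀ n, ∃ k m, search (pre q k) n = some m := by
    intro n
    obtain ⟨m, hm⟩ := hlim n
    have hzero : q (g n m) = 0 := (hq n m).2 fun j hj => (hm j hj).trans (hm m le_rfl).symm
    refine ⟨Nat.pair m (g n m) + 1, Option.isSome_iff_exists.1 ?_⟩
    refine List.findSome?_isSome_iff.2 ⟨Nat.pair m (g n m), by simp [length_pre], ?_⟩
    refine Option.isSome_iff_exists.2 ⟨m, (test_eq _ _ _ _).2 ?_⟩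
    simp only [Nat.unpair_pair, and_true]
    exact pre_getElem?.2 ⟨Nat.lt_succ_of_le (Nat.right_le_pair _ _), hzero⟩
  refine ⟨fun r => ⟨r = q, fun _ => p⟩, ⟨fun u n => (search u n).map fun m => f m n, ?_, ?_, ?_⟩,
    rfl, rfl⟩
  · exact Computable.option_map hsearch.to_comp
      (hf.comp Computable.snd (Computable.snd.comp Computable.fst))
  · intro u v n y huv h
    obtain ⟨m, hm, rfl⟩ := Option.map_eq_some_iff.1 h
    simp [search_mono u v n m huv hm]
  · rintro r _ ⟨rfl, rfl⟩ n
    obtain ⟨k, m, hm⟩ := search_complete n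
    exact ⟨k, by simp [hm, search_sound k n m hm]⟩

/-- **Shoenfield's limit lemma.** A point `p ∈ ℕ^ℕ` is limit computable (i.e. the
pointwise limit of a computable sequence in `ℕ^ℕ`) if and only if `p ≤_T 0'`,
i.e. `p` is computable relative to the halting problem. -/
theorem shoenfield_limit_lemma (p : Baire) :
    (∃ f : ℕ → ℕ → ℕ, Computable₂ f ∧ ∀ n, ∃ i₀, ∀ i, i₀ ≤ i → f i n = p n) ↔
      TuringLe p zero' := by
  constructor
  · rintro ⟨f, hf, hlim⟩
    have hunpair := Primrec.unpair.to_comp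
    have hn : Computable fun x : ℕ × ℕ => x.1.unpair.1 :=
      Computable.fst.comp (hunpair.comp Computable.fst)
    have hm : Computable fun x : ℕ × ℕ => x.1.unpair.2 :=
      Computable.snd.comp (hunpair.comp Computable.fst)
    have hchange : Computable₂ fun a j : ℕ =>
        !(f (a.unpair.2 + j) a.unpair.1 == f a.unpair.2 a.unpair.1) :=
      Primrec.not.to_comp.comp <| Primrec.beq.to_comp.comp
        (hf.comp (Primrec.nat_add.to_comp.comp hm Computable.snd) hn) (hf.comp hm hn)
    obtain ⟨g, hg, hquery⟩ := exists_primrec_query hchange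
    refine turingLe_of_queries (g := fun n m => g (Nat.pair n m)) hf
      (hg.comp Primrec₂.natPair) hlim fun n m => ?_
    rw [hquery]
    simp only [Nat.unpair_pair, Bool.not_eq_false', beq_iff_eq]
    refine ⟨fun h j hj => ?_, fun h j => h _ (Nat.le_add_right m j)⟩
    rw [← h (j - m), Nat.add_sub_cancel' hj]
  · intro h
    obtain ⟨z, hz, hlim⟩ := exists_primrec_approx_zero'
    refine h.exists_limit hlim (Primrec.to_comp ?_)
    simp only [pre_eq_map_range]
    exact Primrec.list_map Primrec.list_range hz

end LimitComp
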